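/- arXiv:0912.4569 — 6 statements merged into one kernel-verified Lean document; each statement's English description precedes it below -/
import Mathlib

section
/- Let 0 < λ ≤ 1/11 be a real number. Let c, c_p ≥ 0 and c_j, c_j', ĉ, ĉ_j, ĉ_j', R be real numbers satisfying: (1) R ≥ c_j − c_j' (the recent items account for the increase in count); (2) |ĉ_j − c_j| ≤ λ·c and |ĉ_j' − c_j'| ≤ λ·c_p (the local sketches are λ-accurate); (3) ĉ ≥ (1 − λ/6)·c (the total-count sketch is accurate); (4) ĉ_j > ĉ_j' + 9λ·ĉ (an up event occurs); and (5) c_p ≤ (6/5)·c (the follow-up is absolute). Then R ≥ 6λ·c. -/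
/-- Arithmetic core of Lemma 2.1(i): an absolute follow-up's recent items
number at least `6λ·c`. -/
theorem stmt_0 (lam c cp cj cj' chat chatj chatj' R : ℝ)
    (hlam : 0 < lam) (hlam' : lam ≤ 1 / 11)
    (hc : 0 ≤ c) (hcp : 0 ≤ cp)
    (hR : R ≥ cj - cj')
    (hj : |chatj - cj| ≤ lam * c)
    (hj' : |chatj' - cj'| ≤ lam * cp)
    (hhat : chat ≥ (1 - lam / 6) * c)
    (hup : chatj > chatj' + 9 * lam * chat)
    (habs : cp ≤ 6 / 5 * c) :
    R ≥ 6 * lam * c := by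
  have hchat : lam * ((1 - lam / 6) * c) ≤ lam * chat :=
    mul_le_mul_of_nonneg_left hhat hlam.le
  have hcp' : lam * cp ≤ lam * (6 / 5 * c) := mul_le_mul_of_nonneg_left habs hlam.le
  have hsq : lam * c * lam ≤ lam * c * (1 / 11) :=
    mul_le_mul_of_nonneg_left hlam' (mul_nonneg hlam.le hc)
  have hlc : 0 ≤ lam * c := mul_nonneg hlam.le hc
  obtain ⟨-, hj₂⟩ := abs_le.mp hj
  obtain ⟨hj₁, -⟩ := abs_le.mp hj'
  linarith
end

section
/- Let f : ℤ → ℕ, let W ≥ 1 be an integer, and for an integer u define c(u) = ∑_{s = u−W+1}^{u} f(s) and, for a fixed integer t_o, define H(u) = ∑_{s = u−W+1}^{t_o − 1} f(s). Let p, v be integers with t_o ≤ p < v ≤ t_o + W − 1. If 5·c(p) > 6·c(v), then 6·H(v) < 5·H(p). -/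
/-- A sum over an integer interval splits at any point `b` of the interval. -/
theorem Finset.sum_Icc_split_int {M : Type*} [AddCommMonoid M] (f : ℤ → M) {a b c : ℤ}
    (hab : a ≤ b) (hbc : b - 1 ≤ c) :
    ∑ s ∈ Finset.Icc a c, f s =
      ∑ s ∈ Finset.Icc a (b - 1), f s + ∑ s ∈ Finset.Icc b c, f s := by
  rw [← Finset.sum_union]
  · congr 1
    ext s
    simp only [Finset.mem_union, Finset.mem_Icc]
    omega
  · rw [Finset.disjoint_left]
    intro s hs hs'
    rw [Finset.mem_Icc] at hs hs'
    omega

/-- Lemma 2.2(i): if a relative follow-up occurs at `v` with previous-event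
time `p`, i.e. `c(p) > (6/5)·c(v)`, then `H(v) < (5/6)·H(p)`. -/
theorem stmt_5 (f : ℤ → ℕ) (W : ℤ) (hW : 1 ≤ W) (t_o p v : ℤ)
    (hpv : t_o ≤ p) (hpv' : p < v) (hvt : v ≤ t_o + W - 1)
    (hc : 5 * ∑ s ∈ Finset.Icc (p - W + 1) p, f s >
          6 * ∑ s ∈ Finset.Icc (v - W + 1) v, f s) :
    6 * ∑ s ∈ Finset.Icc (v - W + 1) (t_o - 1), f s <
    5 * ∑ s ∈ Finset.Icc (p - W + 1) (t_o - 1), f s := by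
  rw [Finset.sum_Icc_split_int f (show v - W + 1 ≤ t_o by omega) (show t_o - 1 ≤ v by omega),
    Finset.sum_Icc_split_int f (show p - W + 1 ≤ t_o by omega) (show t_o - 1 ≤ p by omega)] at hc
  have hmono : ∑ s ∈ Finset.Icc t_o p, f s ≤ ∑ s ∈ Finset.Icc t_o v, f s :=
    Finset.sum_le_sum_of_subset (Finset.Icc_subset_Icc_right hpv'.le)
  omega
end

section
/- Let 0 < λ ≤ 1/11 be a real number. Let c_t ≥ 0, c_d ≥ 0 and c_j, c_j', ĉ_t, ĉ_d, ĉ_j, ĉ_j', F be real numbers satisfying: (1) F ≥ c_j − c_j' (the expiring items account for the decrease in count); (2) |ĉ_j − c_j| ≤ λ·c_t and |ĉ_j' − c_j'| ≤ λ·c_d; (3) ĉ_t ≥ (1 − λ/6)·c_t and ĉ_d ≤ (1 + λ/6)·c_d; (4) ĉ_j > 9λ·ĉ_t (an up event occurs at the first time) and ĉ_j' < 3λ·ĉ_d (an off event occurs at the second time); and (5) c_d ≤ (6/5)·c_t. Then F ≥ λ·c_t. -/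
/-- Arithmetic core of Lemma 2.4(i): a poor-up with an absolute off has
at least `λ·c(t_i)` copies of item `j` expiring in between. -/
theorem stmt_10 (lam ct cd cj cj' chatt chatd chatj chatj' F : ℝ)
    (hlam : 0 < lam) (hlam' : lam ≤ 1 / 11)
    (hct : 0 ≤ ct) (hcd : 0 ≤ cd)
    (hF : F ≥ cj - cj')
    (hj : |chatj - cj| ≤ lam * ct)
    (hj' : |chatj' - cj'| ≤ lam * cd)
    (hhatt : chatt ≥ (1 - lam / 6) * ct)
    (hhatd : chatd ≤ (1 + lam / 6) * cd)
    (hup : chatj > 9 * lam * chatt)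
    (hoff : chatj' < 3 * lam * chatd)
    (habs : cd ≤ 6 / 5 * ct) :
    F ≥ lam * ct := by
  have h_t : lam * ((1 - lam / 6) * ct) ≤ lam * chatt := by gcongr
  have h_d : lam * chatd ≤ lam * ((1 + lam / 6) * cd) := by gcongr
  have h_cd : lam * (4 + lam / 2) * cd ≤ lam * (4 + lam / 2) * (6 / 5 * ct) := by gcongr
  have h_lam : lam * ct * lam ≤ lam * ct * (1 / 11) := by gcongr
  have h_nonneg : 0 ≤ lam * ct := by positivity
  linarith [(abs_le.mp hj).2, (abs_le.mp hj').1]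
end

section
/- Let f : ℤ → ℕ, let W ≥ 1 be an integer, and for an integer u define c(u) = ∑_{s = u−W+1}^{u} f(s). Let t_o, v, d be integers with t_o ≤ v < d ≤ t_o + W − 1. If 5·c(d) > 6·c(v), then 5·∑_{s = t_o}^{d} f(s) > 6·∑_{s = t_o}^{v} f(s). -/
theorem Int.sum_Icc_add_sum_Icc {M : Type*} [AddCommMonoid M] (f : ℤ → M) {a b c : ℤ}
    (hab : a ≤ b + 1) (hbc : b ≤ c) :
    ∑ s ∈ Finset.Icc a b, f s + ∑ s ∈ Finset.Icc (b + 1) c, f s = ∑ s ∈ Finset.Icc a c, f s := by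
  rw [← Finset.sum_union]
  · congr 1
    ext x
    simp only [Finset.mem_union, Finset.mem_Icc]
    omega
  · rw [Finset.disjoint_left]
    intro x hx hx'
    rw [Finset.mem_Icc] at hx hx'
    omega


/-- Lemma 2.5(i): if a poor-up at `v` has a relative off at `d`
(i.e. `c(d) > (6/5)·c(v)`), then `|σ_[t_o,d]| > (6/5)·|σ_[t_o,v]|`. -/
theorem stmt_12 (f : ℤ → ℕ) (W : ℤ) (hW : 1 ≤ W) (t_o v d : ℤ)
    (hv : t_o ≤ v) (hvd : v < d) (hd : d ≤ t_o + W - 1)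
    (hc : 5 * ∑ s ∈ Finset.Icc (d - W + 1) d, f s >
          6 * ∑ s ∈ Finset.Icc (v - W + 1) v, f s) :
    5 * ∑ s ∈ Finset.Icc t_o d, f s > 6 * ∑ s ∈ Finset.Icc t_o v, f s := by
  have hwin_d := Int.sum_Icc_add_sum_Icc f (a := d - W + 1) (b := t_o - 1) (c := d)
    (by omega) (by omega)
  have hwin_v := Int.sum_Icc_add_sum_Icc f (a := d - W + 1) (b := t_o - 1) (c := v)
    (by omega) (by omega)
  have hmono : ∑ s ∈ Finset.Icc (d - W + 1) v, f s ≤ ∑ s ∈ Finset.Icc (v - W + 1) v, f s :=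
    Finset.sum_le_sum_of_subset (Finset.Icc_subset_Icc_left (by omega))
  rw [sub_add_cancel] at hwin_d hwin_v
  omega
end

section
/- Let k ≥ 1 be an integer, let 0 < ε < 1 and ε ≤ φ ≤ 1 be real numbers, and for each i ∈ {1, …, k} let c_i ≥ 0, c'_i, r_i, r'_i be real numbers satisfying |r_i − c_i| ≤ (ε/24)·c_i and |r'_i − c'_i| ≤ (11ε/24)·c_i. If ∑_{i=1}^{k} r'_i ≥ (φ − ε/2)·∑_{i=1}^{k} r_i, then ∑_{i=1}^{k} c'_i ≥ (φ − ε)·∑_{i=1}^{k} c_i. -/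
/-- Soundness of the frequent-items protocol (Section 3): every returned
item has global frequency at least `φ − ε`. -/
theorem stmt_14 (k : ℕ) (hk : 1 ≤ k) (ε φ : ℝ)
    (hε0 : 0 < ε) (hε1 : ε < 1) (hφ1 : ε ≤ φ) (hφ2 : φ ≤ 1)
    (c c' r r' : Fin k → ℝ)
    (hc : ∀ i, 0 ≤ c i)
    (hr : ∀ i, |r i - c i| ≤ ε / 24 * c i)
    (hr' : ∀ i, |r' i - c' i| ≤ 11 * ε / 24 * c i)
    (hret : ∑ i, r' i ≥ (φ - ε / 2) * ∑ i, r i) :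
    ∑ i, c' i ≥ (φ - ε) * ∑ i, c i := by
  have hC : 0 ≤ ∑ i, c i := Finset.sum_nonneg fun i _ => hc i
  have hR : (1 - ε / 24) * ∑ i, c i ≤ ∑ i, r i := by
    rw [Finset.mul_sum]
    exact Finset.sum_le_sum fun i _ => by linarith [(abs_le.mp (hr i)).1]
  have hR' : ∑ i, r' i ≤ ∑ i, c' i + 11 * ε / 24 * ∑ i, c i := by
    rw [Finset.mul_sum, ← Finset.sum_add_distrib]
    exact Finset.sum_le_sum fun i _ => by linarith [(abs_le.mp (hr' i)).2]
  have hmul := mul_le_mul_of_nonneg_left hR (show 0 ≤ φ - ε / 2 by linarith)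
  have hslack : 0 ≤ ε * (1 - (φ - ε / 2)) * ∑ i, c i :=
    mul_nonneg (mul_nonneg hε0.le (by linarith)) hC
  linarith
end

section
/- Let k ≥ 1 be an integer, let 0 < ε < 1 and ε ≤ φ ≤ 1 be real numbers, and for each i ∈ {1, …, k} let c_i ≥ 0, c'_i, r_i, r'_i be real numbers satisfying |r_i − c_i| ≤ (ε/24)·c_i and |r'_i − c'_i| ≤ (11ε/24)·c_i. If ∑_{i=1}^{k} r'_i < (φ − ε/2)·∑_{i=1}^{k} r_i, then ∑_{i=1}^{k} c'_i < φ·∑_{i=1}^{k} c_i. -/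
/-- Completeness of the frequent-items protocol (Section 3): every item
not returned has global frequency below `φ`. -/
theorem stmt_15 (k : ℕ) (hk : 1 ≤ k) (ε φ : ℝ)
    (hε0 : 0 < ε) (hε1 : ε < 1) (hφ1 : ε ≤ φ) (hφ2 : φ ≤ 1)
    (c c' r r' : Fin k → ℝ)
    (hc : ∀ i, 0 ≤ c i)
    (hr : ∀ i, |r i - c i| ≤ ε / 24 * c i)
    (hr' : ∀ i, |r' i - c' i| ≤ 11 * ε / 24 * c i)
    (hret : ∑ i, r' i < (φ - ε / 2) * ∑ i, r i) :
    ∑ i, c' i < φ * ∑ i, c i := by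
  have hC : 0 ≤ ∑ i, c i := Finset.sum_nonneg fun i _ => hc i
  have hR : ∑ i, r i ≤ (1 + ε / 24) * ∑ i, c i := by
    rw [Finset.mul_sum]
    exact Finset.sum_le_sum fun i _ => by linarith [(abs_le.mp (hr i)).2]
  have hC' : ∑ i, c' i ≤ ∑ i, r' i + 11 * ε / 24 * ∑ i, c i := by
    rw [Finset.mul_sum, ← Finset.sum_add_distrib]
    exact Finset.sum_le_sum fun i _ => by linarith [(abs_le.mp (hr' i)).1]
  have hscaled : (φ - ε / 2) * ∑ i, r i ≤ (φ - ε / 2) * ((1 + ε / 24) * ∑ i, c i) :=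
    mul_le_mul_of_nonneg_left hR (by linarith)
  have hslack : 0 ≤ ε * (1 - φ + ε / 2) * ∑ i, c i :=
    mul_nonneg (mul_nonneg hε0.le (by linarith)) hC
  linarith
end
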